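/- Let Ω ⊂ ℝ² be an open, bounded, uniformly convex set. Let f⁺ = h⁺·ℋ¹|_{∂Ω} and f⁻ = h⁻·ℋ¹|_{∂Ω}, where h⁺, h⁻ : ∂Ω → [0,∞) are bounded Borel functions with f⁺(∂Ω) = f⁻(∂Ω), and let γ be an optimal transport plan between f⁺ and f⁻. Then the transport density σ_γ is locally bounded in Ω: for every compact set K ⊂ Ω there exists a constant C such that σ_γ(A) ≤ C · Leb(A) for every Borel set A ⊆ K. -/

import Mathlib

open MeasureTheory Set Metric Filter
open scoped ENNReal NNReal Topology

noncomputable section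

/-- A transport plan between the measures `μ` and `ν`: a positive measure on the product
whose first marginal is `μ` and whose second marginal is `ν`. -/
def IsTransportPlan {α : Type*} [MeasurableSpace α] (μ ν : Measure α)
    (γ : Measure (α × α)) : Prop :=
  γ.map Prod.fst = μ ∧ γ.map Prod.snd = ν

/-- The transport cost of a plan `γ` for the distance cost `c(x,y) = |x - y|`. -/
def transportCost {α : Type*} [MeasurableSpace α] [PseudoEMetricSpace α]
    (γ : Measure (α × α)) : ℝ≥0∞ :=
  ∫⁻ p, edist p.1 p.2 ∂γ

/-- `γ` is an optimal transport plan between `μ` and `ν` for the cost `|x - y|`. -/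
def IsOptimalPlan {α : Type*} [MeasurableSpace α] [PseudoEMetricSpace α] (μ ν : Measure α)
    (γ : Measure (α × α)) : Prop :=
  IsTransportPlan μ ν γ ∧
    ∀ γ' : Measure (α × α), IsTransportPlan μ ν γ' → transportCost γ ≤ transportCost γ'

/-- The transport density of a plan `γ`, as a set function:
`σ_γ(A) = ∫ ℋ¹([x,y] ∩ A) dγ(x,y)`. -/
def transportDensity {d : ℕ}
    (γ : Measure (EuclideanSpace ℝ (Fin d) × EuclideanSpace ℝ (Fin d)))
    (A : Set (EuclideanSpace ℝ (Fin d))) : ℝ≥0∞ :=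
  ∫⁻ p, μH[1] (segment ℝ p.1 p.2 ∩ A) ∂γ

/-- An open bounded set `Ω` is uniformly convex if it is convex and there is `R > 0` such
that for every boundary point `x` there is a unit vector `n` with `Ω ⊆ B(x + Rn, R)`. -/
def UniformlyConvexSet {d : ℕ} (Ω : Set (EuclideanSpace ℝ (Fin d))) : Prop :=
  Convex ℝ Ω ∧ ∃ R > (0 : ℝ), ∀ x ∈ frontier Ω, ∃ n : EuclideanSpace ℝ (Fin d),
    ‖n‖ = 1 ∧ Ω ⊆ Metric.ball (x + R • n) R

/-- The (topological) support of a measure: the points all of whose neighbourhoods have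
positive measure.  For finite Borel measures on a second-countable space this is the smallest
closed set of full measure. -/
def msupport {α : Type*} [TopologicalSpace α] [MeasurableSpace α] (μ : Measure α) : Set α :=
  {x | ∀ U ∈ nhds x, μ U ≠ 0}

/-- `n` is a unit vector pointing from `x` strictly into `Ω`: the half-space
`{q | 0 < ⟪n, q - x⟫}` contains `Ω`. -/
def IsInnerNormal {V : Type*} [NormedAddCommGroup V] [InnerProductSpace ℝ V]
    (Ω : Set V) (x n : V) : Prop :=
  ‖n‖ = 1 ∧ ∀ q ∈ Ω, 0 < inner ℝ n (q - x)

namespace IsInnerNormal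

variable {V : Type*} [NormedAddCommGroup V] [InnerProductSpace ℝ V] {Ω : Set V}

theorem inner_nonneg {x n q : V} (h : IsInnerNormal Ω x n) (hq : q ∈ closure Ω) :
    0 ≤ inner ℝ n (q - x) := by
  have hc : IsClosed {q : V | 0 ≤ inner ℝ n (q - x)} :=
    isClosed_le continuous_const (by fun_prop)
  exact closure_minimal (fun q hq => (h.2 q hq).le) hc hq

theorem abs_inner_le {x n : V} (h : IsInnerNormal Ω x n) (v : V) : |inner ℝ n v| ≤ ‖v‖ := by
  simpa [h.1] using abs_real_inner_le_norm n v

theorem le_inner_of_ball_subset {x n w : V} {ρ : ℝ} (h : IsInnerNormal Ω x n)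
    (hw : ball w ρ ⊆ Ω) (hρ : 0 < ρ) : ρ ≤ inner ℝ n (w - x) := by
  refine le_of_forall_lt fun s hs => ?_
  have hs' : max s 0 < ρ := max_lt hs hρ
  have hmem : w - (max s 0) • n ∈ Ω := hw (by
    simp [norm_smul, h.1, abs_of_nonneg, hs, hρ])
  have := h.2 _ hmem
  rw [sub_right_comm, inner_sub_right, real_inner_smul_right, real_inner_self_eq_norm_sq, h.1]
    at this
  linarith [le_max_left s 0]

/-- If `x'` lies within `h` of a point of the ray from `w` through `y`, where `x'` and `y` are
boundary points and `w` is deep inside, then that point of the ray is close to `y`. -/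
theorem abs_sub_one_mul_le {y x' n n' w v : V} {ρ h τ : ℝ} (hn : IsInnerNormal Ω y n)
    (hn' : IsInnerNormal Ω x' n') (hy : y ∈ closure Ω) (hx' : x' ∈ closure Ω)
    (hw : ball w ρ ⊆ Ω) (hρ : 0 < ρ) (hτ : 0 ≤ τ) (hv : ‖v‖ ≤ h)
    (heq : x' - w = τ • (y - w) + v) : |τ - 1| * ρ ≤ h := by
  have h1 := hn.le_inner_of_ball_subset hw hρ
  have h2 := hn.inner_nonneg hx'
  have h3 := hn'.le_inner_of_ball_subset hw hρ
  have h4 := hn'.inner_nonneg hy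
  have e1 : x' - y = (1 - τ) • (w - y) + v := by
    rw [← sub_sub_sub_cancel_right x' y w, heq]; module
  have e2 : w - x' = τ • (w - y) - v := by
    rw [← neg_sub, heq]; module
  have e3 : y - x' = (τ - 1) • (w - y) - v := by
    rw [← neg_sub, e1]; module
  rw [e1, inner_add_right, real_inner_smul_right] at h2
  rw [e2, inner_sub_right, real_inner_smul_right] at h3
  rw [e3, inner_sub_right, real_inner_smul_right] at h4
  have a1 := abs_le.1 (hn.abs_inner_le v)
  have a2 := abs_le.1 (hn'.abs_inner_le v)
  rcases le_total τ 1 with h | h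
  · rw [abs_of_nonpos (by linarith)]
    nlinarith [mul_le_mul_of_nonneg_left h3 (sub_nonneg.2 h), mul_nonneg hτ h4]
  · rw [abs_of_nonneg (by linarith)]
    nlinarith [mul_le_mul_of_nonneg_left h1 (sub_nonneg.2 h)]

/-- Two chords from `y` through a common interior point have the same other endpoint. -/
theorem eq_of_mem_segment {x x' y n n' c : V} (hn : IsInnerNormal Ω x n)
    (hn' : IsInnerNormal Ω x' n') (hx : x ∈ closure Ω) (hx' : x' ∈ closure Ω)
    (hyΩ : y ∉ Ω) (hc : c ∈ Ω) (h : c ∈ segment ℝ x y) (h' : c ∈ segment ℝ x' y) : x = x' := by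
  obtain ⟨a, b, ha, hb, hab, rfl⟩ := h
  obtain ⟨a', b', ha', hb', hab', h'⟩ := h'
  have hap : 0 < a := ha.lt_of_ne (by
    rintro rfl
    obtain rfl : b = 1 := by linarith
    exact hyΩ (by simpa using hc))
  have hap' : 0 < a' := ha'.lt_of_ne (by
    rintro rfl
    obtain rfl : b' = 1 := by linarith
    rw [zero_smul, one_smul, zero_add] at h'
    exact hyΩ (h' ▸ hc))
  obtain rfl : b = 1 - a := by linarith
  obtain rfl : b' = 1 - a' := by linarith
  have key : a' • (x' - y) = a • (x - y) := by
    have : a' • (x' - y) = a' • x' + (1 - a') • y - y := by module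
    rw [this, h']; module
  have hxy : x' - y = (a / a') • (x - y) := by
    rw [div_eq_inv_mul, mul_smul, ← key, inv_smul_smul₀ hap'.ne']
  set k := a / a' with hk
  have hkp : 0 < k := by positivity
  have e1 : (a • x + (1 - a) • y) - x = (-(1 - a)) • (x - y) := by module
  have e2 : (a • x + (1 - a) • y) - x' = (a - k) • (x - y) := by
    rw [← sub_sub_sub_cancel_right _ x' y, hxy]; module
  have e3 : x' - x = (k - 1) • (x - y) := by
    rw [← sub_sub_sub_cancel_right x' x y, hxy]; module
  have e4 : x - x' = (1 - k) • (x - y) := by rw [← neg_sub, e3]; module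
  have h1 := hn.2 _ hc
  have h2 := hn'.2 _ hc
  have h3 := hn.inner_nonneg hx'
  have h4 := hn'.inner_nonneg hx
  rw [e1, real_inner_smul_right] at h1
  rw [e2, real_inner_smul_right] at h2
  rw [e3, real_inner_smul_right] at h3
  rw [e4, real_inner_smul_right] at h4
  have hk' : k - a = a / a' * (1 - a') := by rw [hk]; field_simp
  have : k = 1 := by
    have i1 : inner ℝ n (x - y) < 0 := by nlinarith
    have i2 : inner ℝ n' (x - y) < 0 := by
      have : 0 ≤ k - a := by rw [hk']; positivity
      nlinarith
    apply le_antisymm <;> nlinarith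
  rw [this] at e4
  simpa [sub_eq_zero] using e4

end IsInnerNormal

theorem IsInnerNormal.eq_of_crossing {V : Type*} [NormedAddCommGroup V] [InnerProductSpace ℝ V]
    {Ω : Set V} {x y x' y' n n' c : V} (hn : IsInnerNormal Ω x n)
    (hn' : IsInnerNormal Ω x' n') (hx : x ∈ closure Ω) (hx' : x' ∈ closure Ω)
    (hyΩ : y ∉ Ω) (hc : c ∈ Ω) (h : c ∈ segment ℝ x y) (h' : c ∈ segment ℝ x' y')
    (hmono : dist x y + dist x' y' ≤ dist x y' + dist x' y) : x = x' := by
  refine hn.eq_of_mem_segment hn' hx hx' hyΩ hc h ?_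
  have d1 := dist_add_dist_of_mem_segment h
  have d2 := dist_add_dist_of_mem_segment h'
  rw [mem_segment_iff_wbtw, ← dist_add_dist_eq_iff]
  linarith [dist_triangle x c y', dist_triangle x' c y]

theorem hausdorffMeasure_one_le_of_antilipschitz {X : Type*} [MetricSpace X] [MeasurableSpace X]
    [BorelSpace X] {S : Set X} {f : X → ℝ} {K : ℝ≥0} {c r : ℝ}
    (hf : ∀ q ∈ S, ∀ q' ∈ S, dist q q' ≤ K * |f q - f q'|) (hr : ∀ q ∈ S, |f q - c| ≤ r) :
    μH[1] S ≤ K * ENNReal.ofReal (2 * r) := by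
  have hanti : AntilipschitzWith K (fun q : S => f q) :=
    AntilipschitzWith.of_le_mul_dist fun q q' => hf q q.2 q' q'.2
  have h1 := hanti.le_hausdorffMeasure_image (d := 1) zero_le_one univ
  have h2 := (isometry_subtype_coe (s := S)).hausdorffMeasure_image (d := 1)
    (Or.inl zero_le_one) univ
  rw [image_univ, Subtype.range_coe] at h2
  rw [h2]
  refine h1.trans ?_
  rw [ENNReal.rpow_one, hausdorffMeasure_real, ← Real.volume_closedBall c]
  gcongr
  rintro _ ⟨q, -, rfl⟩
  exact hr q q.2

theorem hausdorffMeasure_segment_inter_closedBall_le {V : Type*} [NormedAddCommGroup V]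
    [InnerProductSpace ℝ V] [MeasurableSpace V] [BorelSpace V] (x y z : V) (r : ℝ) :
    μH[1] (segment ℝ x y ∩ closedBall z r) ≤ ENNReal.ofReal (2 * r) := by
  set e : V := ‖y - x‖⁻¹ • (y - x) with he
  have hle : ‖e‖ ≤ 1 := by
    rw [he, norm_smul, norm_inv, norm_norm]; exact inv_mul_le_one
  have := hausdorffMeasure_one_le_of_antilipschitz (S := segment ℝ x y ∩ closedBall z r)
    (f := fun q => inner ℝ e q) (K := 1) (c := inner ℝ e z) (r := r) ?_ ?_
  · simpa using this
  · rintro q ⟨hq, -⟩ q' ⟨hq', -⟩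
    rw [segment_eq_image'] at hq hq'
    obtain ⟨s, -, rfl⟩ := hq
    obtain ⟨t, -, rfl⟩ := hq'
    rw [← inner_sub_right, dist_eq_norm, add_sub_add_left_eq_sub, ← sub_smul, norm_smul,
      real_inner_smul_right, he, real_inner_smul_left, real_inner_self_eq_norm_sq, abs_mul]
    rcases eq_or_ne ‖y - x‖ 0 with h | h
    · simp [h]
    · have : ‖y - x‖⁻¹ * ‖y - x‖ ^ 2 = ‖y - x‖ := by field_simp
      simp [this]
  · rintro q ⟨-, hq⟩
    rw [← inner_sub_right]
    rw [mem_closedBall, dist_eq_norm] at hq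
    exact (abs_real_inner_le_norm _ _).trans (by nlinarith [norm_nonneg e, norm_nonneg (q - z)])

/-- Rotation of the plane by a quarter turn. -/
def quarterTurn (v : EuclideanSpace ℝ (Fin 2)) : EuclideanSpace ℝ (Fin 2) := !₂[-v 1, v 0]

theorem norm_quarterTurn (v : EuclideanSpace ℝ (Fin 2)) : ‖quarterTurn v‖ = ‖v‖ := by
  simp [quarterTurn, EuclideanSpace.norm_eq, Fin.sum_univ_two, add_comm]

theorem inner_quarterTurn_self (v : EuclideanSpace ℝ (Fin 2)) :
    inner ℝ (quarterTurn v) v = 0 := by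
  simp [quarterTurn, PiLp.inner_apply, Fin.sum_univ_two]; ring

theorem eq_inner_smul_add_inner_quarterTurn_smul {v : EuclideanSpace ℝ (Fin 2)} (hv : ‖v‖ = 1)
    (q : EuclideanSpace ℝ (Fin 2)) :
    q = inner ℝ v q • v + inner ℝ (quarterTurn v) q • quarterTurn v := by
  have h : v 0 ^ 2 + v 1 ^ 2 = 1 := by
    have := EuclideanSpace.real_norm_sq_eq v
    rw [hv, Fin.sum_univ_two] at this
    linarith
  ext i
  fin_cases i
  · simp [quarterTurn, PiLp.inner_apply, Fin.sum_univ_two]; linear_combination (-q 0) * h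
  · simp [quarterTurn, PiLp.inner_apply, Fin.sum_univ_two]; linear_combination (-q 1) * h

theorem hausdorffMeasure_normal_cone_le {Ω : Set (EuclideanSpace ℝ (Fin 2))}
    {v : EuclideanSpace ℝ (Fin 2)} (hv : ‖v‖ = 1) (a : EuclideanSpace ℝ (Fin 2)) (r : ℝ) :
    μH[1] {x ∈ closure Ω ∩ closedBall a r | ∃ n, IsInnerNormal Ω x n ∧
      |inner ℝ n (quarterTurn v)| ≤ inner ℝ n v} ≤ ENNReal.ofReal (4 * r) := by
  have hu : ‖quarterTurn v‖ = 1 := (norm_quarterTurn v).trans hv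
  refine (hausdorffMeasure_one_le_of_antilipschitz (f := fun q => inner ℝ (quarterTurn v) q)
    (K := 2) (c := inner ℝ (quarterTurn v) a) (r := r) ?_ ?_).trans_eq ?_
  · have key : ∀ d n : EuclideanSpace ℝ (Fin 2), ‖n‖ = 1 →
        |inner ℝ n (quarterTurn v)| ≤ inner ℝ n v → inner ℝ n d ≤ 0 →
        inner ℝ v d ≤ |inner ℝ (quarterTurn v) d| := by
      intro d n hn hnv hnd
      have hn' := eq_inner_smul_add_inner_quarterTurn_smul hv n
      have hd' := eq_inner_smul_add_inner_quarterTurn_smul hv d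
      rw [real_inner_comm n, real_inner_comm n] at hn'
      have hpos : 0 < inner ℝ n v := by
        refine ((abs_nonneg _).trans hnv).lt_of_ne fun h0 => ?_
        rw [← h0] at hnv
        rw [← h0, abs_nonpos_iff.1 hnv] at hn'
        simp [hn'] at hn
      rw [hd', inner_add_right, real_inner_smul_right, real_inner_smul_right] at hnd
      by_contra! hlt
      have h1 : |inner ℝ (quarterTurn v) d * inner ℝ n (quarterTurn v)|
          ≤ |inner ℝ (quarterTurn v) d| * inner ℝ n v := by
        rw [abs_mul]; gcongr
      have h2 := (abs_le.1 h1).1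
      nlinarith
    rintro q ⟨⟨hq, -⟩, n, hn, hnv⟩ q' ⟨⟨hq', -⟩, n', hn', hnv'⟩
    have h1 := hn.inner_nonneg hq'
    have h2 := hn'.inner_nonneg hq
    have h3 := key (q - q') n hn.1 hnv (by rw [← neg_sub, inner_neg_right]; linarith)
    have h4 := key (q' - q) n' hn'.1 hnv' (by rw [← neg_sub, inner_neg_right]; linarith)
    rw [← neg_sub, inner_neg_right, inner_neg_right, abs_neg] at h4
    have h5 : |inner ℝ v (q - q')| ≤ |inner ℝ (quarterTurn v) (q - q')| :=
      abs_le.2 ⟨by linarith, h3⟩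
    have h6 := eq_inner_smul_add_inner_quarterTurn_smul hv (q - q')
    rw [← inner_sub_right, dist_eq_norm]
    calc ‖q - q'‖ ≤ ‖inner ℝ v (q - q') • v‖ +
          ‖inner ℝ (quarterTurn v) (q - q') • quarterTurn v‖ := by
          conv_lhs => rw [h6]
          exact norm_add_le _ _
      _ ≤ _ := by
          rw [norm_smul, norm_smul, hv, hu, Real.norm_eq_abs, Real.norm_eq_abs]
          push_cast
          linarith
  · rintro q ⟨⟨-, hq⟩, -⟩
    rw [← inner_sub_right]
    rw [mem_closedBall, dist_eq_norm] at hq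
    exact (abs_real_inner_le_norm _ _).trans (by rwa [hu, one_mul])
  · rw [← ENNReal.ofReal_coe_nnreal, ← ENNReal.ofReal_mul (by positivity)]
    congr 1
    push_cast
    ring

/-- The boundary of a planar set with inner normals has length at most `16 r` in any disc of
radius `r`. -/
theorem hausdorffMeasure_frontier_inter_closedBall_le {Ω : Set (EuclideanSpace ℝ (Fin 2))}
    (hN : ∀ x ∈ frontier Ω, ∃ n, IsInnerNormal Ω x n) (a : EuclideanSpace ℝ (Fin 2)) (r : ℝ) :
    μH[1] (frontier Ω ∩ closedBall a r) ≤ 4 * ENNReal.ofReal (4 * r) := by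
  set e : EuclideanSpace ℝ (Fin 2) := !₂[1, 0]
  set e' : EuclideanSpace ℝ (Fin 2) := !₂[0, 1]
  have he : ‖e‖ = 1 := by simp [e, EuclideanSpace.norm_eq, Fin.sum_univ_two]
  have he' : ‖e'‖ = 1 := by simp [e', EuclideanSpace.norm_eq, Fin.sum_univ_two]
  let S (v : EuclideanSpace ℝ (Fin 2)) : Set (EuclideanSpace ℝ (Fin 2)) :=
    {x ∈ closure Ω ∩ closedBall a r | ∃ n, IsInnerNormal Ω x n ∧
      |inner ℝ n (quarterTurn v)| ≤ inner ℝ n v}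
  have hS (v) (hv : ‖v‖ = 1) : μH[1] (S v) ≤ ENNReal.ofReal (4 * r) :=
    hausdorffMeasure_normal_cone_le hv a r
  have hcov : frontier Ω ∩ closedBall a r ⊆ (S e ∪ S (-e)) ∪ (S e' ∪ S (-e')) := by
    rintro x ⟨hx, hxr⟩
    obtain ⟨n, hn⟩ := hN x hx
    have hm (v) (h : |inner ℝ n (quarterTurn v)| ≤ inner ℝ n v) : x ∈ S v :=
      ⟨⟨frontier_subset_closure hx, hxr⟩, n, hn, h⟩
    rcases le_total |n 0| |n 1| with h | h
    · right
      rcases le_total 0 (n 1) with h' | h'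
      · left; apply hm
        simpa [e', quarterTurn, PiLp.inner_apply, Fin.sum_univ_two, abs_of_nonneg h'] using h
      · right; apply hm
        simpa [e', quarterTurn, PiLp.inner_apply, Fin.sum_univ_two, abs_of_nonpos h'] using h
    · left
      rcases le_total 0 (n 0) with h' | h'
      · left; apply hm
        simpa [e, quarterTurn, PiLp.inner_apply, Fin.sum_univ_two, abs_of_nonneg h'] using h
      · right; apply hm
        simpa [e, quarterTurn, PiLp.inner_apply, Fin.sum_univ_two, abs_of_nonpos h'] using h
  calc _ ≤ μH[1] ((S e ∪ S (-e)) ∪ (S e' ∪ S (-e'))) := measure_mono hcov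
    _ ≤ (μH[1] (S e) + μH[1] (S (-e))) + (μH[1] (S e') + μH[1] (S (-e'))) :=
      (measure_union_le _ _).trans (add_le_add (measure_union_le _ _) (measure_union_le _ _))
    _ ≤ (ENNReal.ofReal (4 * r) + ENNReal.ofReal (4 * r)) +
        (ENNReal.ofReal (4 * r) + ENNReal.ofReal (4 * r)) := by
      gcongr <;> exact hS _ (by simp [he, he'])
    _ = _ := by ring

/-- A chord whose endpoints lie strictly on both sides of another chord, and which passes through
the interior, crosses that other chord in the interior. -/
theorem exists_mem_segment_of_inner_quarterTurn_neg {Ω : Set (EuclideanSpace ℝ (Fin 2))}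
    (hΩc : Convex ℝ Ω) (hΩo : IsOpen Ω) (hN : ∀ x ∈ frontier Ω, ∃ n, IsInnerNormal Ω x n)
    {x y x' y' w' e : EuclideanSpace ℝ (Fin 2)} {l : ℝ} (hx : x ∈ frontier Ω) (hy : y ∈ frontier Ω)
    (hx' : x' ∈ frontier Ω) (hy' : y' ∈ frontier Ω) (he : ‖e‖ = 1)
    (hl : l ≠ 0) (hxy : y - x = l • e)
    (hw' : w' ∈ segment ℝ x' y') (hwΩ' : w' ∈ Ω)
    (hneg : inner ℝ (quarterTurn e) (x' - x) * inner ℝ (quarterTurn e) (y' - x) < 0) :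
    ∃ c ∈ Ω, c ∈ segment ℝ x y ∧ c ∈ segment ℝ x' y' := by
  set J := quarterTurn e
  set A := inner ℝ J (x' - x) with hA
  set B := inner ℝ J (y' - x) with hB
  have hAB : A - B ≠ 0 := by
    intro h
    rw [sub_eq_zero.1 h] at hneg
    nlinarith
  set b := A / (A - B) with hb
  have hb0 : 0 < b := by
    rcases mul_neg_iff.1 hneg with ⟨h1, h2⟩ | ⟨h1, h2⟩
    · exact div_pos h1 (by linarith)
    · exact div_pos_of_neg_of_neg h1 (by linarith)
  have hb1 : 0 < 1 - b := by
    have : 1 - b = -B / (A - B) := by rw [hb]; field_simp; ring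
    rw [this]
    rcases mul_neg_iff.1 hneg with ⟨h1, h2⟩ | ⟨h1, h2⟩
    · exact div_pos (by linarith) (by linarith)
    · exact div_pos_of_neg_of_neg (by linarith) (by linarith)
  set c := (1 - b) • x' + b • y' with hc
  have hcseg : c ∈ segment ℝ x' y' := ⟨1 - b, b, hb1.le, hb0.le, by ring, rfl⟩
  have hccl : c ∈ closure Ω := hΩc.closure.segment_subset (frontier_subset_closure hx')
    (frontier_subset_closure hy') hcseg
  have hcΩ : c ∈ Ω := by
    by_contra hcn
    obtain ⟨n, hn⟩ := hN c (by rw [hΩo.frontier_eq]; exact ⟨hccl, hcn⟩)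
    have h1 := hn.inner_nonneg (frontier_subset_closure hx')
    have h2 := hn.inner_nonneg (frontier_subset_closure hy')
    have h3 := hn.2 _ hwΩ'
    obtain ⟨s, t, hs, ht, hst, rfl⟩ := hw'
    have e1 : x' - c = b • (x' - y') := by rw [hc]; module
    have e2 : y' - c = (-(1 - b)) • (x' - y') := by rw [hc]; module
    have e3 : s • x' + t • y' - c = (b - t) • (x' - y') := by
      obtain rfl : s = 1 - t := by linarith
      rw [hc]; module
    rw [e1, real_inner_smul_right] at h1
    rw [e2, real_inner_smul_right] at h2
    rw [e3, real_inner_smul_right] at h3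
    have : inner ℝ n (x' - y') = 0 := by apply le_antisymm <;> nlinarith
    simp [this] at h3
  refine ⟨c, hcΩ, ?_, hcseg⟩
  have hJc : inner ℝ J (c - x) = 0 := by
    have : c - x = (1 - b) • (x' - x) + b • (y' - x) := by rw [hc]; module
    rw [this, inner_add_right, real_inner_smul_right, real_inner_smul_right, ← hA, ← hB, hb]
    field_simp
    ring
  obtain ⟨k, hk⟩ : ∃ k : ℝ, c - x = k • (y - x) := by
    refine ⟨inner ℝ e (c - x) / l, ?_⟩
    have h := eq_inner_smul_add_inner_quarterTurn_smul he (c - x)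
    rwa [hJc, zero_smul, add_zero, ← div_mul_cancel₀ (inner ℝ e (c - x)) hl, mul_smul, ← hxy]
      at h
  obtain ⟨n, hn⟩ := hN x hx
  obtain ⟨m, hm⟩ := hN y hy
  have h1 := hn.2 _ hcΩ
  have h2 := hn.inner_nonneg (frontier_subset_closure hy)
  have h3 := hm.2 _ hcΩ
  have h4 := hm.inner_nonneg (frontier_subset_closure hx)
  have e1 : c - y = (1 - k) • (x - y) := by
    rw [← sub_sub_sub_cancel_right c y x, hk]; module
  rw [hk, real_inner_smul_right] at h1
  rw [e1, real_inner_smul_right] at h3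
  have hk0 : 0 < k := pos_of_mul_pos_left h1 h2
  have hk1 : 0 < 1 - k := pos_of_mul_pos_left h3 h4
  exact ⟨1 - k, k, hk1.le, hk0.le, by ring, by rw [← sub_add_cancel c x, hk]; module⟩

/-- If two boundary-to-boundary chords do not cross in the interior and pass within distance `s` of
each other at points deep inside, then an endpoint of one is close to an endpoint of the other. -/
theorem dist_le_or_dist_le_of_chords {Ω : Set (EuclideanSpace ℝ (Fin 2))}
    (hΩc : Convex ℝ Ω) (hΩo : IsOpen Ω) (hN : ∀ x ∈ frontier Ω, ∃ n, IsInnerNormal Ω x n)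
    {x y x' y' w w' : EuclideanSpace ℝ (Fin 2)} {ρ s D : ℝ}
    (hD : ∀ p ∈ closure Ω, ∀ q ∈ closure Ω, dist p q ≤ D)
    (hx : x ∈ frontier Ω) (hy : y ∈ frontier Ω) (hx' : x' ∈ frontier Ω) (hy' : y' ∈ frontier Ω)
    (hw : w ∈ segment ℝ x y) (hw' : w' ∈ segment ℝ x' y') (hρ : 0 < ρ)
    (hwΩ : ball w ρ ⊆ Ω) (hwΩ' : ball w' ρ ⊆ Ω) (hs : dist w w' ≤ s)
    (hmono : dist x y + dist x' y' ≤ dist x y' + dist x' y) :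
    dist x' x ≤ s * D / ρ * (D / ρ + 1) ∨ dist x' y ≤ s * D / ρ * (D / ρ + 1) := by
  have hcl {p} (hp : p ∈ frontier Ω) : p ∈ closure Ω := frontier_subset_closure hp
  have hnot {p} (hp : p ∈ frontier Ω) : p ∉ Ω := by
    rw [hΩo.frontier_eq] at hp; exact hp.2
  have hD0 : 0 ≤ D := dist_nonneg.trans (hD x (hcl hx) x (hcl hx))
  have hs0 : 0 ≤ s := dist_nonneg.trans hs
  obtain ⟨n, hn⟩ := hN x hx
  obtain ⟨m, hm⟩ := hN y hy
  obtain ⟨n', hn'⟩ := hN x' hx'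
  have hxy : x ≠ y := by
    rintro rfl
    rw [segment_same] at hw
    exact hnot hx (hw ▸ hwΩ (mem_ball_self hρ))
  set l := ‖y - x‖ with hl
  have hl0 : l ≠ 0 := norm_ne_zero_iff.2 (sub_ne_zero.2 hxy.symm)
  set e := l⁻¹ • (y - x) with he
  have hle : y - x = l • e := by rw [he, smul_inv_smul₀ hl0]
  have he1 : ‖e‖ = 1 := by rw [he, norm_smul, norm_inv, hl, norm_norm, inv_mul_cancel₀ hl0]
  clear_value e l
  set J := quarterTurn e with hJ
  have hJ1 : ‖J‖ = 1 := (norm_quarterTurn e).trans he1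
  by_cases hneg : inner ℝ J (x' - x) * inner ℝ J (y' - x) < 0
  · obtain ⟨c, hcΩ, hc, hc'⟩ := exists_mem_segment_of_inner_quarterTurn_neg hΩc hΩo hN hx hy hx'
      hy' he1 hl0 hle hw' (hwΩ' (mem_ball_self hρ)) hneg
    left
    rw [hn.eq_of_crossing hn' (hcl hx) (hcl hx') (hnot hy) hcΩ hc hc' hmono, dist_self]
    positivity
  obtain ⟨a, b, ha, hb, hab, rfl⟩ := hw
  obtain ⟨a', b', ha', hb', hab', hwe⟩ := hw'
  obtain rfl : a = 1 - b := by linarith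
  obtain rfl : b' = 1 - a' := by linarith
  set w := (1 - b) • x + b • y with hwdef
  have hρa : ρ ≤ a' * D := by
    have h1 : ρ ≤ dist y' w' := by
      by_contra! h
      exact hnot hy' (hwΩ' h)
    have h2 : y' - w' = a' • (y' - x') := by rw [← hwe]; module
    rw [dist_eq_norm, h2, norm_smul, Real.norm_of_nonneg ha', ← dist_eq_norm] at h1
    exact h1.trans (by gcongr; exact hD _ (hcl hy') _ (hcl hx'))
  have hJe : inner ℝ J e = 0 := inner_quarterTurn_self e
  have hJw : inner ℝ J (w - x) = 0 := by
    have : w - x = (b * l) • e := by rw [mul_smul, ← hle, hwdef]; module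
    rw [this, real_inner_smul_right, hJe, mul_zero]
  have hh : |inner ℝ J (x' - x)| ≤ s * D / ρ := by
    have h1 : |inner ℝ J (w' - x)| ≤ s := by
      have : w' - x = (w' - w) + (w - x) := by abel
      rw [this, inner_add_right, hJw, add_zero]
      refine (abs_real_inner_le_norm _ _).trans ?_
      rwa [hJ1, one_mul, ← dist_eq_norm, dist_comm]
    have h2 : w' - x = a' • (x' - x) + (1 - a') • (y' - x) := by rw [← hwe]; module
    rw [h2, inner_add_right, real_inner_smul_right, real_inner_smul_right] at h1
    have h3 : a' * |inner ℝ J (x' - x)| ≤ s := by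
      refine le_trans ?_ h1
      rw [← abs_of_nonneg ha', ← abs_mul, abs_of_nonneg ha']
      apply sq_le_sq.1
      nlinarith [mul_nonneg (mul_nonneg ha' hb') (not_lt.1 hneg),
        sq_nonneg ((1 - a') * inner ℝ J (y' - x))]
    rw [le_div_iff₀ hρ]
    calc _ ≤ |inner ℝ J (x' - x)| * (a' * D) := by gcongr
      _ = (a' * |inner ℝ J (x' - x)|) * D := by ring
      _ ≤ s * D := by gcongr
  set h := s * D / ρ with hh'
  have hh0 : 0 ≤ h := by positivity
  set v := inner ℝ J (x' - x) • J with hv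
  have hvn : ‖v‖ ≤ h := by rwa [hv, norm_smul, hJ1, mul_one]
  obtain ⟨k, hk⟩ : ∃ k : ℝ, x' - w = k • (y - x) + v := by
    refine ⟨inner ℝ e (x' - w) / l, ?_⟩
    have h1 := eq_inner_smul_add_inner_quarterTurn_smul he1 (x' - w)
    have h2 : x' - w = (x' - x) - (w - x) := by abel
    have h3 : inner ℝ J (x' - w) = inner ℝ J (x' - x) := by
      rw [h2, inner_sub_right, hJw, sub_zero]
    rwa [← hJ, h3, ← div_mul_cancel₀ (inner ℝ e (x' - w)) hl0, mul_smul, ← hle] at h1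
  have hwcl : w ∈ closure Ω := subset_closure (hwΩ (mem_ball_self hρ))
  have final {p m : EuclideanSpace ℝ (Fin 2)} {τ : ℝ} (hp : p ∈ frontier Ω)
      (hm : IsInnerNormal Ω p m) (hτ : 0 ≤ τ) (heq : x' - w = τ • (p - w) + v) :
      dist x' p ≤ h * (D / ρ + 1) := by
    have h1 := hm.abs_sub_one_mul_le hn' (hcl hp) (hcl hx') hwΩ hρ hτ hvn heq
    have h2 : x' - p = (τ - 1) • (p - w) + v := by
      rw [← sub_sub_sub_cancel_right x' p w, heq]; module
    rw [← le_div_iff₀ hρ] at h1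
    rw [dist_eq_norm, h2]
    calc _ ≤ |τ - 1| * ‖p - w‖ + ‖v‖ := by
          refine (norm_add_le _ _).trans_eq ?_
          rw [norm_smul, Real.norm_eq_abs]
      _ ≤ h / ρ * D + h := by
          gcongr
          rw [← dist_eq_norm]
          exact hD _ (hcl hp) _ hwcl
      _ = _ := by ring
  have hwx : w ≠ x := fun h => hnot hx (h ▸ hwΩ (mem_ball_self hρ))
  have hwy : w ≠ y := fun h => hnot hy (h ▸ hwΩ (mem_ball_self hρ))
  have hb0 : b ≠ 0 := by
    rintro rfl
    exact hwx (by rw [hwdef]; module)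
  have hb1 : 1 - b ≠ 0 := by
    intro h0
    obtain rfl : b = 1 := by linarith
    exact hwy (by rw [hwdef]; module)
  rcases le_total 0 k with hk0 | hk0
  · right
    refine final (τ := k / (1 - b)) hy hm (by positivity) ?_
    have : y - w = (1 - b) • (y - x) := by rw [hwdef]; module
    rw [hk, this, smul_smul, div_mul_cancel₀ _ hb1]
  · left
    refine final (τ := (-k) / b) hx hn (div_nonneg (by linarith) hb) ?_
    have : x - w = b • (x - y) := by rw [hwdef]; module
    rw [hk, this, smul_smul, div_mul_cancel₀ _ hb0]
    module

theorem transportCost_add {α : Type*} [MeasurableSpace α] [PseudoEMetricSpace α]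
    (γ γ' : Measure (α × α)) :
    transportCost (γ + γ') = transportCost γ + transportCost γ' := by
  simp [transportCost, lintegral_add_measure]

theorem transportCost_le_of_ae {α : Type*} [MeasurableSpace α] [PseudoMetricSpace α]
    {γ : Measure (α × α)} {B : ℝ} (h : ∀ᵐ p ∂γ, dist p.1 p.2 ≤ B) :
    transportCost γ ≤ ENNReal.ofReal B * γ univ := by
  rw [transportCost, ← lintegral_const]
  refine lintegral_mono_ae (h.mono fun p hp => ?_)
  rw [edist_dist]
  exact ENNReal.ofReal_le_ofReal hp

theorem le_transportCost_of_ae {α : Type*} [MeasurableSpace α] [PseudoMetricSpace α]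
    {γ : Measure (α × α)} {B : ℝ} (h : ∀ᵐ p ∂γ, B ≤ dist p.1 p.2) :
    ENNReal.ofReal B * γ univ ≤ transportCost γ := by
  rw [transportCost, ← lintegral_const]
  refine lintegral_mono_ae (h.mono fun p hp => ?_)
  rw [edist_dist]
  exact ENNReal.ofReal_le_ofReal hp

/-- Two pieces of equal mass of an optimal plan cannot be improved by exchanging their targets. -/
theorem IsOptimalPlan.transportCost_add_le {α : Type*} [MeasurableSpace α] [PseudoEMetricSpace α]
    {μ ν : Measure α} {γ γ₁ γ₂ : Measure (α × α)} (hγ : IsOptimalPlan μ ν γ)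
    [IsFiniteMeasure γ] [IsFiniteMeasure γ₁] [IsFiniteMeasure γ₂] (hcost : transportCost γ ≠ ∞)
    (hle : γ₁ + γ₂ ≤ γ) {c : ℝ≥0∞} (hc : c ≠ 0) (hc' : c ≠ ∞)
    (h₁ : γ₁ univ = c) (h₂ : γ₂ univ = c) :
    transportCost γ₁ + transportCost γ₂ ≤ transportCost (c⁻¹ • γ₁.fst.prod γ₂.snd) +
      transportCost (c⁻¹ • γ₂.fst.prod γ₁.snd) := by
  obtain ⟨ρ, hρ⟩ : ∃ ρ, γ = ρ + (γ₁ + γ₂) :=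
    ⟨γ - (γ₁ + γ₂), (Measure.sub_add_cancel_of_le hle).symm⟩
  have hs {τ : Measure (α × α)} (h : τ univ = c) (m : Measure α) : c⁻¹ • (τ univ • m) = m := by
    rw [h, smul_smul, ENNReal.inv_mul_cancel hc hc', one_smul]
  have hplan : IsTransportPlan μ ν
      (ρ + (c⁻¹ • γ₁.fst.prod γ₂.snd + c⁻¹ • γ₂.fst.prod γ₁.snd)) := by
    have e1 := hγ.1.1
    have e2 := hγ.1.2
    rw [hρ, Measure.map_add _ _ measurable_fst, Measure.map_add _ _ measurable_fst] at e1
    rw [hρ, Measure.map_add _ _ measurable_snd, Measure.map_add _ _ measurable_snd] at e2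
    constructor
    · rw [Measure.map_add _ _ measurable_fst, Measure.map_add _ _ measurable_fst,
        Measure.map_smul, Measure.map_smul, Measure.map_fst_prod, Measure.map_fst_prod,
        Measure.snd_univ, Measure.snd_univ, hs h₂, hs h₁]
      exact e1
    · rw [Measure.map_add _ _ measurable_snd, Measure.map_add _ _ measurable_snd,
        Measure.map_smul, Measure.map_smul, Measure.map_snd_prod, Measure.map_snd_prod,
        Measure.fst_univ, Measure.fst_univ, hs h₂, hs h₁, add_comm γ₂.snd]
      exact e2
  have h := hγ.2 _ hplan
  rw [hρ, transportCost_add, transportCost_add] at hcost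
  rw [hρ, transportCost_add, transportCost_add, transportCost_add, transportCost_add] at h
  exact (ENNReal.add_le_add_iff_left (ENNReal.add_ne_top.1 hcost).1).1 h

/-- Any two points in the support of an optimal plan of finite cost satisfy the two-point cyclical
monotonicity inequality. -/
theorem IsOptimalPlan.dist_add_dist_le {α : Type*} [MeasurableSpace α] [PseudoMetricSpace α]
    [OpensMeasurableSpace α] {μ ν : Measure α} {γ : Measure (α × α)}
    (hγ : IsOptimalPlan μ ν γ) [IsFiniteMeasure γ] (hcost : transportCost γ ≠ ∞)
    {p q : α × α} (hp : p ∈ γ.support) (hq : q ∈ γ.support) :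
    dist p.1 p.2 + dist q.1 q.2 ≤ dist p.1 q.2 + dist q.1 p.2 := by
  by_contra! hlt
  set η := (dist p.1 p.2 + dist q.1 q.2 - (dist p.1 q.2 + dist q.1 p.2)) / 9 with hη
  have hη0 : 0 < η := by rw [hη]; linarith
  have hpos (p) (hp : p ∈ γ.support) : γ (ball p.1 η ×ˢ ball p.2 η) ≠ 0 := by
    rw [ball_prod_same]
    exact ((Measure.mem_support_iff_forall p).1 hp _ (ball_mem_nhds p hη0)).ne'
  set a := γ (ball p.1 η ×ˢ ball p.2 η) with ha
  set b := γ (ball q.1 η ×ˢ ball q.2 η) with hb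
  have ha0 : a ≠ 0 := hpos p hp
  have hb0 : b ≠ 0 := hpos q hq
  have ha1 : a ≠ ∞ := measure_ne_top _ _
  have hb1 : b ≠ ∞ := measure_ne_top _ _
  set c := min a b / 2 with hc
  have hc0 : c ≠ 0 := by
    rw [hc]
    refine (ENNReal.div_pos ?_ (by simp)).ne'
    rcases min_choice a b with h | h <;> rw [h] <;> assumption
  have hc1 : c ≠ ∞ := ((ENNReal.half_le_self.trans (min_le_left a b)).trans_lt ha1.lt_top).ne
  set γ₁ := (c / a) • γ.restrict (ball p.1 η ×ˢ ball p.2 η) with hγ₁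
  set γ₂ := (c / b) • γ.restrict (ball q.1 η ×ˢ ball q.2 η) with hγ₂
  have h₁ : γ₁ univ = c := by
    simp [hγ₁, ← ha, ENNReal.div_mul_cancel ha0 ha1]
  have h₂ : γ₂ univ = c := by
    simp [hγ₂, ← hb, ENNReal.div_mul_cancel hb0 hb1]
  have : IsFiniteMeasure γ₁ := ⟨by rw [h₁]; exact hc1.lt_top⟩
  have : IsFiniteMeasure γ₂ := ⟨by rw [h₂]; exact hc1.lt_top⟩
  have half (d : ℝ≥0∞) (hd0 : d ≠ 0) (hd1 : d ≠ ∞) (hcd : min a b ≤ d) : c / d ≤ 2⁻¹ := by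
    rw [ENNReal.div_le_iff hd0 hd1, hc, ENNReal.div_eq_inv_mul]
    gcongr
  have hle : γ₁ + γ₂ ≤ γ := by
    calc γ₁ + γ₂ ≤ (2⁻¹ : ℝ≥0∞) • γ + (2⁻¹ : ℝ≥0∞) • γ := by
          refine Measure.le_intro fun s _ _ => ?_
          simp only [hγ₁, hγ₂, Measure.add_apply, Measure.smul_apply, smul_eq_mul]
          gcongr
          · exact half a ha0 ha1 (min_le_left _ _)
          · exact Measure.restrict_le_self
          · exact half b hb0 hb1 (min_le_right _ _)
          · exact Measure.restrict_le_self
      _ = γ := by rw [← add_smul, ENNReal.inv_two_add_inv_two, one_smul]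
  have key := hγ.transportCost_add_le hcost hle hc0 hc1 h₁ h₂
  have hae₁ : ∀ᵐ z ∂γ₁, z.1 ∈ ball p.1 η ∧ z.2 ∈ ball p.2 η :=
    Measure.ae_smul_measure (ae_restrict_mem (measurableSet_ball.prod measurableSet_ball)) _
  have hae₂ : ∀ᵐ z ∂γ₂, z.1 ∈ ball q.1 η ∧ z.2 ∈ ball q.2 η :=
    Measure.ae_smul_measure (ae_restrict_mem (measurableSet_ball.prod measurableSet_ball)) _
  have low {τ : Measure (α × α)} {x y : α} (h : ∀ᵐ z ∂τ, z.1 ∈ ball x η ∧ z.2 ∈ ball y η)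
      (hτ : τ univ = c) : ENNReal.ofReal (dist x y - 2 * η) * c ≤ transportCost τ := by
    rw [← hτ]
    refine le_transportCost_of_ae (h.mono fun z hz => ?_)
    have h1 := mem_ball.1 hz.1
    have h2 := mem_ball.1 hz.2
    linarith [dist_triangle4 x z.1 z.2 y, dist_comm x z.1]
  have up {τ τ' : Measure (α × α)} [IsFiniteMeasure τ] [IsFiniteMeasure τ'] {x y x' y' : α}
      (h : ∀ᵐ z ∂τ, z.1 ∈ ball x η ∧ z.2 ∈ ball y η)
      (h' : ∀ᵐ z ∂τ', z.1 ∈ ball x' η ∧ z.2 ∈ ball y' η) (hτ : τ univ = c) (hτ' : τ' univ = c) :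
      transportCost (c⁻¹ • τ.fst.prod τ'.snd) ≤ ENNReal.ofReal (dist x y' + 2 * η) * c := by
    have hu : (c⁻¹ • τ.fst.prod τ'.snd) univ = c := by
      rw [Measure.smul_apply, ← univ_prod_univ, Measure.prod_prod, Measure.fst_univ,
        Measure.snd_univ, hτ, hτ', smul_eq_mul, ← mul_assoc, ENNReal.inv_mul_cancel hc0 hc1,
        one_mul]
    conv_rhs => rw [← hu]
    refine transportCost_le_of_ae (Measure.ae_smul_measure ?_ _)
    have a1 : ∀ᵐ u ∂τ.fst, u ∈ ball x η :=
      (ae_map_iff measurable_fst.aemeasurable measurableSet_ball).2 (h.mono fun z hz => hz.1)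
    have a2 : ∀ᵐ u ∂τ'.snd, u ∈ ball y' η :=
      (ae_map_iff measurable_snd.aemeasurable measurableSet_ball).2 (h'.mono fun z hz => hz.2)
    filter_upwards [Measure.quasiMeasurePreserving_fst.ae a1,
      Measure.quasiMeasurePreserving_snd.ae a2] with z h1 h2
    rw [mem_ball] at h1 h2
    linarith [dist_triangle4 z.1 x y' z.2, dist_comm y' z.2]
  have fin := ((add_le_add (low hae₁ h₁) (low hae₂ h₂)).trans key).trans
    (add_le_add (up hae₁ hae₂ h₁ h₂) (up hae₂ hae₁ h₂ h₁))
  rw [← add_mul, ← add_mul, ENNReal.mul_le_mul_iff_left hc0 hc1,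
    ← ENNReal.ofReal_add (p := dist p.1 q.2 + 2 * η) (by positivity) (by positivity)] at fin
  have fin' := ENNReal.ofReal_add_le.trans fin
  rw [ENNReal.ofReal_le_ofReal_iff (by positivity)] at fin'
  linarith

theorem UniformlyConvexSet.exists_isInnerNormal {d : ℕ} {Ω : Set (EuclideanSpace ℝ (Fin d))}
    (h : UniformlyConvexSet Ω) {x : EuclideanSpace ℝ (Fin d)} (hx : x ∈ frontier Ω) :
    ∃ n, IsInnerNormal Ω x n := by
  obtain ⟨-, R, hR, hΩ⟩ := h
  obtain ⟨n, hn, hsub⟩ := hΩ x hx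
  refine ⟨n, hn, fun q hq => ?_⟩
  have h1 := hsub hq
  rw [mem_ball, dist_eq_norm, ← sub_sub] at h1
  have h2 := norm_sub_sq_real (q - x) (R • n)
  rw [norm_smul, hn, real_inner_smul_right, Real.norm_of_nonneg hR.le, real_inner_comm] at h2
  have h3 : ‖q - x - R • n‖ ^ 2 < R ^ 2 := by gcongr
  nlinarith [sq_nonneg ‖q - x‖]

theorem withDensity_restrict_apply_le {α : Type*} [MeasurableSpace α] {μ : Measure α}
    {F B : Set α} {f : α → ℝ} {M : ℝ} (hf : ∀ x, f x ≤ M) (hB : MeasurableSet B) :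
    (μ.restrict F).withDensity (fun x => ENNReal.ofReal (f x)) B
      ≤ ENNReal.ofReal M * μ (F ∩ B) := by
  rw [withDensity_apply _ hB, inter_comm, ← Measure.restrict_apply hB, ← setLIntegral_const]
  exact lintegral_mono fun x => ENNReal.ofReal_le_ofReal (hf x)

/-- If the mass of segments meeting a small disc is bounded by a multiple of its radius, then the
transport density is bounded by a multiple of Lebesgue measure. -/
theorem transportDensity_le_of_segments
    {γ : Measure (EuclideanSpace ℝ (Fin 2) × EuclideanSpace ℝ (Fin 2))}
    {A : Set (EuclideanSpace ℝ (Fin 2))} {C : ℝ≥0} {ρ : ℝ} (hρ : 0 < ρ)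
    (h : ∀ z ∈ A, ∀ r ∈ Ioo 0 ρ, γ {p | (segment ℝ p.1 p.2 ∩ closedBall z r).Nonempty}
      ≤ C * ENNReal.ofReal r) :
    transportDensity γ A ≤ (2 * C : ℝ≥0) * volume A := by
  have key : ∀ ε : ℝ≥0∞, ε ≠ 0 → transportDensity γ A ≤ (2 * C : ℝ≥0) * (volume A + ε) := by
    intro ε hε
    obtain ⟨t, r, ht, htA, hr, hcov, hsum⟩ :=
      Besicovitch.exists_closedBall_covering_tsum_measure_le
        (volume : Measure (EuclideanSpace ℝ (Fin 2))) hε (fun _ => Ioo 0 ρ) A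
        (fun x _ δ hδ => ⟨min ρ δ / 2, ⟨by positivity, by
          linarith [min_le_left ρ δ, lt_min hρ hδ]⟩, by positivity, by
          linarith [min_le_right ρ δ, lt_min hρ hδ]⟩)
    have := ht.to_subtype
    let E (z : t) : Set (EuclideanSpace ℝ (Fin 2) × EuclideanSpace ℝ (Fin 2)) :=
      {p | (segment ℝ p.1 p.2 ∩ closedBall z.1 (r z)).Nonempty}
    have hpt (p : EuclideanSpace ℝ (Fin 2) × EuclideanSpace ℝ (Fin 2)) :
        μH[1] (segment ℝ p.1 p.2 ∩ A) ≤
          ∑' z : t, (toMeasurable γ (E z)).indicator (fun _ => ENNReal.ofReal (2 * r z)) p := by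
      calc _ ≤ μH[1] (⋃ z : t, segment ℝ p.1 p.2 ∩ closedBall z.1 (r z)) := by
            refine measure_mono ?_
            rw [← inter_iUnion]
            refine inter_subset_inter_right _ (hcov.trans_eq (biUnion_eq_iUnion _ _))
        _ ≤ ∑' z : t, μH[1] (segment ℝ p.1 p.2 ∩ closedBall z.1 (r z)) := measure_iUnion_le _
        _ ≤ _ := by
            refine ENNReal.tsum_le_tsum fun z => ?_
            by_cases hp : p ∈ E z
            · rw [indicator_of_mem (subset_toMeasurable γ _ hp)]
              exact hausdorffMeasure_segment_inter_closedBall_le _ _ _ _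
            · have h0 : segment ℝ p.1 p.2 ∩ closedBall z.1 (r z) = ∅ :=
                not_nonempty_iff_eq_empty.1 hp
              rw [h0, measure_empty]
              exact zero_le
    calc transportDensity γ A
        ≤ ∫⁻ p, ∑' z : t,
            (toMeasurable γ (E z)).indicator (fun _ => ENNReal.ofReal (2 * r z)) p ∂γ :=
          lintegral_mono hpt
      _ = ∑' z : t, ENNReal.ofReal (2 * r z) * γ (E z) := by
          rw [lintegral_tsum fun z =>
            (measurable_const.indicator (measurableSet_toMeasurable _ _)).aemeasurable]
          congr 1 with z
          rw [lintegral_indicator_const (measurableSet_toMeasurable _ _), measure_toMeasurable]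
      _ ≤ ∑' z : t, (2 * C : ℝ≥0) * volume (closedBall z.1 (r z)) := by
          refine ENNReal.tsum_le_tsum fun z => ?_
          have hpi : (1 : ℝ≥0∞) ≤ ENNReal.ofReal Real.pi := by
            rw [ENNReal.one_le_ofReal]
            linarith [Real.pi_gt_three]
          calc _ ≤ ENNReal.ofReal (2 * r z) * (C * ENNReal.ofReal (r z)) := by
                gcongr
                exact h z (htA z.2) _ (hr z z.2)
            _ = (2 * C : ℝ≥0) * (ENNReal.ofReal (r z) ^ 2 * 1) := by
                rw [ENNReal.ofReal_mul zero_le_two, ENNReal.ofReal_ofNat]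
                push_cast
                ring
            _ ≤ _ := by
                rw [EuclideanSpace.volume_closedBall_fin_two]
                gcongr
      _ ≤ _ := by
          rw [ENNReal.tsum_mul_left]
          gcongr
  have hlim : Tendsto (fun ε : ℝ≥0∞ => ((2 * C : ℝ≥0) : ℝ≥0∞) * (volume A + ε)) (𝓝[≠] 0)
      (𝓝 ((2 * C : ℝ≥0) * (volume A + 0))) :=
    (ENNReal.Tendsto.const_mul (tendsto_const_nhds.add tendsto_id)
      (Or.inr ENNReal.coe_ne_top)).mono_left nhdsWithin_le_nhds
  rw [add_zero] at hlim
  exact ge_of_tendsto hlim (eventually_mem_nhdsWithin.mono fun ε hε => key ε hε)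

/-- in two dimensions, for boundary data with bounded densities w.r.t.
`ℋ¹|_{∂Ω}`, the transport density is locally bounded in `Ω`. -/
theorem stmt3
    (Ω : Set (EuclideanSpace ℝ (Fin 2)))
    (hΩo : IsOpen Ω) (hΩb : Bornology.IsBounded Ω) (hΩuc : UniformlyConvexSet Ω)
    (hp hm : EuclideanSpace ℝ (Fin 2) → ℝ)
    (hhpm : Measurable hp) (hhmm : Measurable hm)
    (hhp0 : ∀ x, 0 ≤ hp x) (hhm0 : ∀ x, 0 ≤ hm x)
    (M : ℝ) (hhpM : ∀ x, hp x ≤ M) (hhmM : ∀ x, hm x ≤ M)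
    (fplus fminus : Measure (EuclideanSpace ℝ (Fin 2)))
    (hfp : fplus = ((μH[(1 : ℝ)]).restrict (frontier Ω)).withDensity
      (fun x => ENNReal.ofReal (hp x)))
    (hfm : fminus = ((μH[(1 : ℝ)]).restrict (frontier Ω)).withDensity
      (fun x => ENNReal.ofReal (hm x)))
    (hmass : fplus Set.univ = fminus Set.univ)
    (γ : Measure (EuclideanSpace ℝ (Fin 2) × EuclideanSpace ℝ (Fin 2)))
    (hγ : IsOptimalPlan fplus fminus γ) :
    ∀ K : Set (EuclideanSpace ℝ (Fin 2)), IsCompact K → K ⊆ Ω →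
      ∃ C : ℝ≥0, ∀ A : Set (EuclideanSpace ℝ (Fin 2)), MeasurableSet A → A ⊆ K →
        transportDensity γ A ≤ (C : ℝ≥0∞) * volume A := by
  have hN : ∀ x ∈ frontier Ω, ∃ n, IsInnerNormal Ω x n := fun x hx =>
    hΩuc.exists_isInnerNormal hx
  have hΩc := hΩuc.1
  have hplus (B) (hB : MeasurableSet B) : fplus B ≤ ENNReal.ofReal M * μH[1] (frontier Ω ∩ B) :=
    hfp ▸ withDensity_restrict_apply_le hhpM hB
  have hminus (B) (hB : MeasurableSet B) : fminus B ≤ ENNReal.ofReal M * μH[1] (frontier Ω ∩ B) :=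
    hfm ▸ withDensity_restrict_apply_le hhmM hB
  have hFm : MeasurableSet (frontier Ω) := isClosed_frontier.measurableSet
  have hfst (B) (hB : MeasurableSet B) : γ (Prod.fst ⁻¹' B) = fplus B := by
    rw [← hγ.1.1, Measure.map_apply measurable_fst hB]
  have hsnd (B) (hB : MeasurableSet B) : γ (Prod.snd ⁻¹' B) = fminus B := by
    rw [← hγ.1.2, Measure.map_apply measurable_snd hB]
  have : IsFiniteMeasure γ := by
    obtain ⟨R, hR⟩ := hΩb.closure.subset_closedBall 0
    refine ⟨?_⟩
    rw [← preimage_univ (f := Prod.fst), hfst _ MeasurableSet.univ]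
    refine (hplus _ MeasurableSet.univ).trans_lt (ENNReal.mul_lt_top ENNReal.ofReal_lt_top ?_)
    calc μH[1] (frontier Ω ∩ univ) ≤ μH[1] (frontier Ω ∩ closedBall 0 R) :=
          measure_mono fun x hx => ⟨hx.1, hR (frontier_subset_closure hx.1)⟩
      _ ≤ 4 * ENNReal.ofReal (4 * R) := hausdorffMeasure_frontier_inter_closedBall_le hN 0 R
      _ < ∞ := ENNReal.mul_lt_top (by simp) ENNReal.ofReal_lt_top
  have hae₁ : ∀ᵐ p ∂γ, p.1 ∈ frontier Ω := by
    have h := (hplus _ hFm.compl)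
    rw [inter_compl_self, measure_empty, mul_zero, ← hfst _ hFm.compl] at h
    exact nonpos_iff_eq_zero.1 h
  have hae₂ : ∀ᵐ p ∂γ, p.2 ∈ frontier Ω := by
    have h := (hminus _ hFm.compl)
    rw [inter_compl_self, measure_empty, mul_zero, ← hsnd _ hFm.compl] at h
    exact nonpos_iff_eq_zero.1 h
  set D := diam (closure Ω)
  have hD : ∀ p ∈ closure Ω, ∀ q ∈ closure Ω, dist p q ≤ D := fun p hp q hq =>
    dist_le_diam_of_mem hΩb.closure hp hq
  have hcost : transportCost γ ≠ ∞ := by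
    refine ((transportCost_le_of_ae (B := D) ?_).trans_lt
      (ENNReal.mul_lt_top ENNReal.ofReal_lt_top (measure_lt_top _ _))).ne
    filter_upwards [hae₁, hae₂] with p h1 h2
    exact hD _ (frontier_subset_closure h1) _ (frontier_subset_closure h2)
  intro K hK hKΩ
  obtain ⟨δ, hδ, hδΩ⟩ := hK.exists_thickening_subset_open hΩo hKΩ
  set ρ := δ / 2 with hρdef
  have hρ : 0 < ρ := half_pos hδ
  have hD0 : 0 ≤ D := diam_nonneg
  set L : ℝ≥0 := Real.toNNReal (2 * D / ρ * (D / ρ + 1)) with hL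
  have hLr (r : ℝ) : 2 * r * D / ρ * (D / ρ + 1) = L * r := by
    rw [hL, Real.coe_toNNReal _ (by positivity)]
    ring
  have hmass_le : ∀ z ∈ K, ∀ r ∈ Ioo 0 ρ,
      γ {p | (segment ℝ p.1 p.2 ∩ closedBall z r).Nonempty} ≤
        (M.toNNReal * (32 * L) : ℝ≥0) * ENNReal.ofReal r := by
    intro z hz r hr
    set E := {p : EuclideanSpace ℝ (Fin 2) × EuclideanSpace ℝ (Fin 2) |
      (segment ℝ p.1 p.2 ∩ closedBall z r).Nonempty}
    set G := {p : EuclideanSpace ℝ (Fin 2) × EuclideanSpace ℝ (Fin 2) |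
      p ∈ γ.support ∧ p.1 ∈ frontier Ω ∧ p.2 ∈ frontier Ω}
    have hG : ∀ᵐ p ∂γ, p ∈ G := by
      filter_upwards [Measure.support_mem_ae (μ := γ), hae₁, hae₂] with p h1 h2 h3
      exact ⟨h1, h2, h3⟩
    have hsub : ∃ x y, E ∩ G ⊆ Prod.fst ⁻¹' (closedBall x (L * r) ∪ closedBall y (L * r)) := by
      rcases (E ∩ G).eq_empty_or_nonempty with h | ⟨p, ⟨w, hw, hwz⟩, hp, hp1, hp2⟩
      · exact ⟨0, 0, by simp [h]⟩
      refine ⟨p.1, p.2, ?_⟩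
      rintro q ⟨⟨w', hw', hwz'⟩, hq, hq1, hq2⟩
      have hball {u} (hu : u ∈ closedBall z r) : ball u ρ ⊆ Ω := by
        intro v hv
        refine hδΩ (mem_thickening_iff.2 ⟨z, hz, ?_⟩)
        rw [mem_closedBall] at hu
        rw [mem_ball] at hv
        linarith [dist_triangle v u z, hr.2]
      have hs : dist w w' ≤ 2 * r := by
        rw [mem_closedBall] at hwz hwz'
        linarith [dist_triangle_right w w' z]
      have := dist_le_or_dist_le_of_chords hΩc hΩo hN hD hp1 hp2 hq1 hq2 hw hw' hρ (hball hwz)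
        (hball hwz') hs (hγ.dist_add_dist_le hcost hp hq)
      rwa [hLr] at this
    obtain ⟨x, y, hxy⟩ := hsub
    have hpiece (x) : fplus (closedBall x (L * r)) ≤
        ENNReal.ofReal M * (4 * ENNReal.ofReal (4 * (L * r))) :=
      (hplus _ measurableSet_closedBall).trans
        (by gcongr; exact hausdorffMeasure_frontier_inter_closedBall_le hN _ _)
    calc γ E = γ (E ∩ G) := (measure_inter_conull hG).symm
      _ ≤ fplus (closedBall x (L * r) ∪ closedBall y (L * r)) := by
          rw [← hfst _ (measurableSet_closedBall.union measurableSet_closedBall)]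
          exact measure_mono hxy
      _ ≤ ENNReal.ofReal M * (4 * ENNReal.ofReal (4 * (L * r))) +
          ENNReal.ofReal M * (4 * ENNReal.ofReal (4 * (L * r))) :=
          (measure_union_le _ _).trans (add_le_add (hpiece x) (hpiece y))
      _ = _ := by
          rw [ENNReal.ofReal_mul (by norm_num : (0 : ℝ) ≤ 4), ENNReal.ofReal_mul L.coe_nonneg,
            ENNReal.ofReal_coe_nnreal, ENNReal.ofReal_ofNat, ENNReal.ofReal]
          push_cast
          ring
  exact ⟨_, fun A _ hAK => transportDensity_le_of_segments hρ fun z hz => hmass_le z (hAK hz)⟩
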